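/- arXiv:2205.11006 — 3 statements merged into one kernel-verified Lean document; each statement's English description precedes it below -/
import Mathlib

section
/- For all bounded measurable functions φ₁, φ₂ : [0,∞) → ℝ supported in [0,R₀], (1/N) Σ_{k=1}^N ∫_{ℝ^d} L_{φ₁}[u_k](x) · L_{φ₂}[u_k](x) dx = ∫₀^∞ ∫₀^∞ φ₁(r) φ₂(s) r^{d−1} s^{d−1} G_d(r,s) dr ds. -/
open MeasureTheory Set
open scoped BigOperators

noncomputable section

/-- The surface measure on the unit sphere `S^{d-1} ⊂ ℝ^d` (polar decomposition measure). -/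
def sphMeasure (d : ℕ) : Measure (Metric.sphere (0 : EuclideanSpace ℝ (Fin d)) 1) :=
  (volume : Measure (EuclideanSpace ℝ (Fin d))).toSphere

/-- The data-based integral kernel `G_d`. -/
def Gd (d N : ℕ) (u : Fin N → EuclideanSpace ℝ (Fin d) → ℝ) (r s : ℝ) : ℝ :=
  (N : ℝ)⁻¹ * ∑ i, ∫ η : Metric.sphere (0 : EuclideanSpace ℝ (Fin d)) 1,
    (∫ ξ : Metric.sphere (0 : EuclideanSpace ℝ (Fin d)) 1,
      (∫ x, (u i (x + r • (ξ : EuclideanSpace ℝ (Fin d))) - u i x) *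
        (u i (x + s • (η : EuclideanSpace ℝ (Fin d))) - u i x) ∂volume)
      ∂(sphMeasure d)) ∂(sphMeasure d)

/-- The nonlocal operator `L_φ[u](x) = ∫ φ(|y-x|)(u(y)-u(x)) dy` on `ℝ^d`. -/
def Lopd (d : ℕ) (φ : ℝ → ℝ) (u : EuclideanSpace ℝ (Fin d) → ℝ)
    (x : EuclideanSpace ℝ (Fin d)) : ℝ :=
  ∫ y, φ ‖y - x‖ * (u y - u x)

theorem polar_integral (d : ℕ) (hd : 1 ≤ d) (f : EuclideanSpace ℝ (Fin d) → ℝ)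
    (hf : Integrable f) :
    ∫ x, f x = ∫ r in Ioi (0 : ℝ), r ^ (d - 1) *
      ∫ ξ : Metric.sphere (0 : EuclideanSpace ℝ (Fin d)) 1,
        f (r • (ξ : EuclideanSpace ℝ (Fin d))) ∂(sphMeasure d) := by
  have : Nonempty (Fin d) := ⟨⟨0, hd⟩⟩
  have : Nontrivial (EuclideanSpace ℝ (Fin d)) := inferInstance
  set μ : Measure (EuclideanSpace ℝ (Fin d)) := volume with hμ
  have hdim : Module.finrank ℝ (EuclideanSpace ℝ (Fin d)) = d := by simp
  have hmp := μ.measurePreserving_homeomorphUnitSphereProd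
  rw [hdim] at hmp
  let g : (Metric.sphere (0 : EuclideanSpace ℝ (Fin d)) 1) × Ioi (0 : ℝ) → ℝ :=
    fun p => f ((p.2 : ℝ) • (p.1 : EuclideanSpace ℝ (Fin d)))
  have hg : ∀ x, g (homeomorphUnitSphereProd (EuclideanSpace ℝ (Fin d)) x) = f x := by
    intro x
    have hx : ‖(x : EuclideanSpace ℝ (Fin d))‖ ≠ 0 := norm_ne_zero_iff.2 x.2
    simp only [g, homeomorphUnitSphereProd_apply_snd_coe, homeomorphUnitSphereProd_apply_fst_coe]
    rw [smul_smul, mul_inv_cancel₀ hx, one_smul]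
  have h1 : ∫ x, f x ∂μ = ∫ p, g p ∂(μ.toSphere.prod (.volumeIoiPow (d - 1))) := by
    rw [← hmp.integral_comp (Homeomorph.measurableEmbedding _)]
    simp only [hg]
    rw [integral_subtype_comap (measurableSet_singleton _).compl f, restrict_compl_singleton]
  have hgi : Integrable g (μ.toSphere.prod (.volumeIoiPow (d - 1))) := by
    rw [← hmp.integrable_comp_emb (Homeomorph.measurableEmbedding _)]
    have : g ∘ (homeomorphUnitSphereProd (EuclideanSpace ℝ (Fin d))) = f ∘ Subtype.val := by
      funext x; exact hg x
    rw [this, ← integrableOn_iff_comap_subtypeVal (measurableSet_singleton _).compl]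
    exact hf.integrableOn
  rw [h1, integral_prod_symm _ hgi]
  simp only [Measure.volumeIoiPow, ENNReal.ofReal]
  rw [integral_withDensity_eq_integral_smul]
  · rw [integral_subtype_comap measurableSet_Ioi fun a : ℝ ↦ Real.toNNReal (a ^ (d - 1)) •
        ∫ ξ : Metric.sphere (0 : EuclideanSpace ℝ (Fin d)) 1,
        f (a • (ξ : EuclideanSpace ℝ (Fin d))) ∂(μ.toSphere)]
    refine setIntegral_congr_fun measurableSet_Ioi fun x hx ↦ ?_
    simp only [NNReal.smul_def, Real.coe_toNNReal _ (pow_nonneg hx.out.le _), smul_eq_mul]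
    rfl
  · exact (measurable_subtype_coe.pow_const _).real_toNNReal

theorem radial_integrable (d : ℕ) (R₀ : ℝ) (φ : ℝ → ℝ) (hm : Measurable φ)
    (hb : ∃ M, ∀ r, |φ r| ≤ M) (hs : ∀ r, r ∉ Set.Icc 0 R₀ → φ r = 0) :
    Integrable (fun z : EuclideanSpace ℝ (Fin d) => φ ‖z‖) := by
  obtain ⟨M, hM⟩ := hb
  have h : IntegrableOn (fun z : EuclideanSpace ℝ (Fin d) => φ ‖z‖) (Metric.closedBall 0 R₀) :=
    IntegrableOn.of_bound measure_closedBall_lt_top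
      (hm.comp measurable_norm).aestronglyMeasurable M (.of_forall fun z => hM _)
  refine (integrableOn_iff_integrable_of_support_subset ?_).1 h
  intro z hz
  by_contra hc
  apply hz
  apply hs
  intro h'
  exact hc (by simpa using h'.2)

theorem double_polar (d : ℕ) (hd : 1 ≤ d) (R₀ : ℝ) (φ₁ φ₂ : ℝ → ℝ)
    (hm₁ : Measurable φ₁) (hm₂ : Measurable φ₂)
    (hb₁ : ∃ M, ∀ r, |φ₁ r| ≤ M) (hb₂ : ∃ M, ∀ r, |φ₂ r| ≤ M)
    (hs₁ : ∀ r, r ∉ Set.Icc 0 R₀ → φ₁ r = 0) (hs₂ : ∀ r, r ∉ Set.Icc 0 R₀ → φ₂ r = 0)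
    (H : EuclideanSpace ℝ (Fin d) × EuclideanSpace ℝ (Fin d) → ℝ) (hH : Measurable H)
    (C : ℝ) (hC : ∀ p, |H p| ≤ C) :
    ∫ p : EuclideanSpace ℝ (Fin d) × EuclideanSpace ℝ (Fin d),
        H p * (φ₁ ‖p.1‖ * φ₂ ‖p.2‖) ∂(volume.prod volume)
      = ∫ r in Set.Ioi (0 : ℝ), ∫ s in Set.Ioi (0 : ℝ),
          φ₁ r * φ₂ s * r ^ (d - 1) * s ^ (d - 1) *
            ∫ η : Metric.sphere (0 : EuclideanSpace ℝ (Fin d)) 1,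
              ∫ ξ : Metric.sphere (0 : EuclideanSpace ℝ (Fin d)) 1,
                H (r • (ξ : EuclideanSpace ℝ (Fin d)), s • (η : EuclideanSpace ℝ (Fin d)))
                ∂(sphMeasure d) ∂(sphMeasure d) := by
  have i₁ := radial_integrable d R₀ φ₁ hm₁ hb₁ hs₁
  have i₂ := radial_integrable d R₀ φ₂ hm₂ hb₂ hs₂
  have : IsFiniteMeasure (sphMeasure d) := by unfold sphMeasure; infer_instance
  have hint : Integrable (fun p : EuclideanSpace ℝ (Fin d) × EuclideanSpace ℝ (Fin d) =>
      H p * (φ₁ ‖p.1‖ * φ₂ ‖p.2‖)) (volume.prod volume) :=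
    (i₁.mul_prod i₂).bdd_mul hH.aestronglyMeasurable (.of_forall hC)
  rw [integral_prod _ hint, polar_integral d hd _ hint.integral_prod_left]
  refine setIntegral_congr_fun measurableSet_Ioi fun r hr ↦ ?_
  have hr0 : (0 : ℝ) < r := hr
  have hnorm : ∀ (t : ℝ), 0 < t → ∀ ξ : Metric.sphere (0 : EuclideanSpace ℝ (Fin d)) 1,
      ‖t • (ξ : EuclideanSpace ℝ (Fin d))‖ = t := by
    intro t ht ξ
    rw [norm_smul, Real.norm_of_nonneg ht.le]
    simp
  have hsw : Integrable (Function.uncurry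
      fun (ξ : Metric.sphere (0 : EuclideanSpace ℝ (Fin d)) 1) (w : EuclideanSpace ℝ (Fin d)) =>
        H (r • (ξ : EuclideanSpace ℝ (Fin d)), w) * (φ₁ r * φ₂ ‖w‖))
      ((sphMeasure d).prod volume) := by
    have h1 : Integrable (fun p : (Metric.sphere (0 : EuclideanSpace ℝ (Fin d)) 1) ×
        EuclideanSpace ℝ (Fin d) => φ₁ r * φ₂ ‖p.2‖) ((sphMeasure d).prod volume) :=
      (integrable_const (φ₁ r)).mul_prod i₂
    refine h1.bdd_mul (c := C) ?_ (.of_forall fun p => hC _)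
    have : Measurable fun p : (Metric.sphere (0 : EuclideanSpace ℝ (Fin d)) 1) ×
        EuclideanSpace ℝ (Fin d) => (r • (p.1 : EuclideanSpace ℝ (Fin d)), p.2) := by fun_prop
    exact (hH.comp this).aestronglyMeasurable
  have e1 : ∫ ξ : Metric.sphere (0 : EuclideanSpace ℝ (Fin d)) 1,
      (∫ w, H (r • (ξ : EuclideanSpace ℝ (Fin d)), w) *
        (φ₁ ‖r • (ξ : EuclideanSpace ℝ (Fin d))‖ * φ₂ ‖w‖)) ∂(sphMeasure d)
      = ∫ w, ∫ ξ : Metric.sphere (0 : EuclideanSpace ℝ (Fin d)) 1,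
        H (r • (ξ : EuclideanSpace ℝ (Fin d)), w) * (φ₁ r * φ₂ ‖w‖) ∂(sphMeasure d) := by
    simp only [hnorm r hr0]
    exact integral_integral_swap hsw
  simp only
  have e2 := polar_integral d hd _ hsw.integral_prod_right
  simp only [Function.uncurry] at e2
  rw [e1, e2, ← integral_const_mul]
  refine setIntegral_congr_fun measurableSet_Ioi fun s hs ↦ ?_
  simp only [hnorm s hs, integral_mul_const]
  ring

/-- the autocorrelation of increments -/
def Hker (d : ℕ) (u : EuclideanSpace ℝ (Fin d) → ℝ)
    (p : EuclideanSpace ℝ (Fin d) × EuclideanSpace ℝ (Fin d)) : ℝ :=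
  ∫ x, (u (x + p.1) - u x) * (u (x + p.2) - u x)

theorem Hker_measurable (d : ℕ) (u : EuclideanSpace ℝ (Fin d) → ℝ) (hu : Continuous u) :
    Measurable (Hker d u) := by
  have : StronglyMeasurable (fun q : (EuclideanSpace ℝ (Fin d) × EuclideanSpace ℝ (Fin d)) ×
      EuclideanSpace ℝ (Fin d) => (u (q.2 + q.1.1) - u q.2) * (u (q.2 + q.1.2) - u q.2)) := by
    apply Continuous.stronglyMeasurable
    fun_prop
  exact this.integral_prod_right'.measurable

theorem Hker_bounded (d : ℕ) (u : EuclideanSpace ℝ (Fin d) → ℝ) (hu : Continuous u)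
    (hcs : HasCompactSupport u) : ∃ C, ∀ p, |Hker d u p| ≤ C := by
  obtain ⟨M, hM⟩ := hcs.exists_bound_of_continuous hu
  have hi : Integrable u := hu.integrable_of_hasCompactSupport hcs
  refine ⟨((∫ x, |u x|) + ∫ x, |u x|) * (M + M), fun p => ?_⟩
  have hi1 : Integrable (fun x => |u (x + p.1)|) := (hi.comp_add_right p.1).abs
  have e : ((∫ x, |u x|) + ∫ x, |u x|) * (M + M)
      = ∫ x, (|u (x + p.1)| + |u x|) * (M + M) := by
    rw [integral_mul_const, integral_add hi1 hi.abs,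
      integral_add_right_eq_self (fun x => |u x|) p.1]
  rw [e, ← Real.norm_eq_abs]
  unfold Hker
  refine MeasureTheory.norm_integral_le_of_norm_le (μ := volume) ((hi1.add hi.abs).mul_const _) (.of_forall fun x => ?_)
  rw [norm_mul]
  refine mul_le_mul (norm_sub_le _ _) ((norm_sub_le _ _).trans (add_le_add (hM _) (hM _)))
    (norm_nonneg _) (by positivity)

theorem lop_product (d : ℕ) (R₀ : ℝ) (φ₁ φ₂ : ℝ → ℝ)
    (hm₁ : Measurable φ₁) (hm₂ : Measurable φ₂)
    (hb₁ : ∃ M, ∀ r, |φ₁ r| ≤ M) (hb₂ : ∃ M, ∀ r, |φ₂ r| ≤ M)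
    (hs₁ : ∀ r, r ∉ Set.Icc 0 R₀ → φ₁ r = 0) (hs₂ : ∀ r, r ∉ Set.Icc 0 R₀ → φ₂ r = 0)
    (u : EuclideanSpace ℝ (Fin d) → ℝ) (hu : Continuous u) (hcs : HasCompactSupport u) :
    ∫ x, Lopd d φ₁ u x * Lopd d φ₂ u x =
      ∫ p : EuclideanSpace ℝ (Fin d) × EuclideanSpace ℝ (Fin d),
        Hker d u p * (φ₁ ‖p.1‖ * φ₂ ‖p.2‖) ∂(volume.prod volume) := by
  have i₁ := radial_integrable d R₀ φ₁ hm₁ hb₁ hs₁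
  have i₂ := radial_integrable d R₀ φ₂ hm₂ hb₂ hs₂
  have hL : ∀ (φ : ℝ → ℝ) x, Lopd d φ u x = ∫ z, φ ‖z‖ * (u (x + z) - u x) := by
    intro φ x
    unfold Lopd
    rw [← integral_add_left_eq_self _ x]
    simp
  obtain ⟨M, hM⟩ := hcs.exists_bound_of_continuous hu
  obtain ⟨R, hR⟩ := hcs.isCompact.isBounded.subset_closedBall (0 : EuclideanSpace ℝ (Fin d))
  have hz : ∀ x, R < ‖x‖ → u x = 0 := by
    intro x hx
    by_contra hne
    have := hR (subset_tsupport _ hne)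
    simp at this
    linarith
  let B : Set (EuclideanSpace ℝ (Fin d)) := Metric.closedBall 0 (R + R₀)
  have hB : Integrable (B.indicator (fun _ => (1 : ℝ))) :=
    (integrable_indicator_iff Metric.isClosed_closedBall.measurableSet).2
      (integrableOn_const measure_closedBall_lt_top.ne)
  let F : EuclideanSpace ℝ (Fin d) → EuclideanSpace ℝ (Fin d) × EuclideanSpace ℝ (Fin d) → ℝ :=
    fun x p => ((u (x + p.1) - u x) * (u (x + p.2) - u x)) * (φ₁ ‖p.1‖ * φ₂ ‖p.2‖)
  have hF : Integrable (Function.uncurry F) (volume.prod (volume.prod volume)) := by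
    have h1 := hB.mul_prod (i₁.mul_prod i₂)
    have h2 := h1.bdd_mul (c := (M + M) * (M + M))
      (f := fun q : EuclideanSpace ℝ (Fin d) × EuclideanSpace ℝ (Fin d) × EuclideanSpace ℝ (Fin d)
        => (u (q.1 + q.2.1) - u q.1) * (u (q.1 + q.2.2) - u q.1))
      (Continuous.aestronglyMeasurable (by fun_prop))
      (.of_forall fun q => by
        rw [norm_mul]
        have hb : ∀ a b, ‖u a - u b‖ ≤ M + M := fun a b =>
          (norm_sub_le _ _).trans (add_le_add (hM _) (hM _))
        exact mul_le_mul (hb _ _) (hb _ _) (norm_nonneg _) ((norm_nonneg _).trans (hb 0 0)))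
    refine h2.congr (.of_forall fun q => ?_)
    obtain ⟨x, z, w⟩ := q
    simp only [Function.uncurry, F]
    by_cases hx : x ∈ B
    · simp [hx]
    · rw [indicator_of_notMem hx]
      have hx' : R + R₀ < ‖x‖ := by simpa [B] using hx
      by_cases hzz : ‖z‖ ∈ Set.Icc 0 R₀
      · have h3 : ‖x‖ ≤ ‖x + z‖ + ‖z‖ := by
          have := norm_sub_le (x + z) z
          simpa using this
        have h0 := norm_nonneg z
        rw [hz (x + z) (by linarith [hzz.2]), hz x (by linarith [hzz.2])]
        simp
      · rw [hs₁ _ hzz]; simp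
  calc ∫ x, Lopd d φ₁ u x * Lopd d φ₂ u x = ∫ x, ∫ p, F x p ∂(volume.prod volume) := by
        refine integral_congr_ae (.of_forall fun x => ?_)
        simp only [hL]
        rw [← integral_prod_mul]
        refine integral_congr_ae (.of_forall fun p => ?_)
        simp only [F]
        ring
    _ = ∫ p, (∫ x, F x p) ∂(volume.prod volume) := integral_integral_swap hF
    _ = _ := by
        refine integral_congr_ae (.of_forall fun p => ?_)
        simp only [F, integral_mul_const, Hker]

/-- The bilinear form of the nonlocal operators equals a weighted double integral of the
kernel `G_d`. -/
theorem bilinear_eq_double_integral (d : ℕ) (hd : 1 ≤ d) (R₀ : ℝ) (hR₀ : 0 < R₀)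
    (N : ℕ) (hN : 0 < N) (u : Fin N → EuclideanSpace ℝ (Fin d) → ℝ)
    (hu : ∀ i, Continuous (u i)) (hcs : ∀ i, HasCompactSupport (u i))
    (φ₁ φ₂ : ℝ → ℝ)
    (hm₁ : Measurable φ₁) (hm₂ : Measurable φ₂)
    (hb₁ : ∃ M, ∀ r, |φ₁ r| ≤ M) (hb₂ : ∃ M, ∀ r, |φ₂ r| ≤ M)
    (hs₁ : ∀ r, r ∉ Set.Icc 0 R₀ → φ₁ r = 0) (hs₂ : ∀ r, r ∉ Set.Icc 0 R₀ → φ₂ r = 0) :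
    (N : ℝ)⁻¹ * ∑ k, ∫ x, Lopd d φ₁ (u k) x * Lopd d φ₂ (u k) x
      = ∫ r in Set.Ioi (0 : ℝ), ∫ s in Set.Ioi (0 : ℝ),
          φ₁ r * φ₂ s * r ^ (d - 1) * s ^ (d - 1) * Gd d N u r s := by
  have hmeas := fun k => Hker_measurable d (u k) (hu k)
  choose C hC using fun k => Hker_bounded d (u k) (hu k) (hcs k)
  have : IsFiniteMeasure (sphMeasure d) := by unfold sphMeasure; infer_instance
  have i₁ := radial_integrable d R₀ φ₁ hm₁ hb₁ hs₁
  have i₂ := radial_integrable d R₀ φ₂ hm₂ hb₂ hs₂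
  let H : EuclideanSpace ℝ (Fin d) × EuclideanSpace ℝ (Fin d) → ℝ :=
    fun p => (N : ℝ)⁻¹ * ∑ k, Hker d (u k) p
  have hH : Measurable H := by
    have : Measurable fun p => ∑ k, Hker d (u k) p := Finset.measurable_fun_sum _ fun k _ => hmeas k
    exact this.const_mul _
  have hHb : ∀ p, |H p| ≤ (N : ℝ)⁻¹ * ∑ k, C k := by
    intro p
    simp only [H]
    rw [abs_mul, abs_of_nonneg (by positivity : (0 : ℝ) ≤ (N : ℝ)⁻¹)]
    gcongr
    exact (Finset.abs_sum_le_sum_abs _ _).trans (Finset.sum_le_sum fun k _ => hC k p)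
  have hlhs : (N : ℝ)⁻¹ * ∑ k, ∫ x, Lopd d φ₁ (u k) x * Lopd d φ₂ (u k) x =
      ∫ p : EuclideanSpace ℝ (Fin d) × EuclideanSpace ℝ (Fin d),
        H p * (φ₁ ‖p.1‖ * φ₂ ‖p.2‖) ∂(volume.prod volume) := by
    simp only [fun k => lop_product d R₀ φ₁ φ₂ hm₁ hm₂ hb₁ hb₂ hs₁ hs₂ (u k) (hu k) (hcs k)]
    rw [← integral_finsetSum _ fun k _ =>
      (i₁.mul_prod i₂).bdd_mul (hmeas k).aestronglyMeasurable (.of_forall (hC k)),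
      ← integral_const_mul]
    refine integral_congr_ae (.of_forall fun p => ?_)
    simp only [H, ← Finset.sum_mul]
    ring
  rw [hlhs, double_polar d hd R₀ φ₁ φ₂ hm₁ hm₂ hb₁ hb₂ hs₁ hs₂ H hH _ hHb]
  refine setIntegral_congr_fun measurableSet_Ioi fun r _ ↦ ?_
  refine setIntegral_congr_fun measurableSet_Ioi fun s _ ↦ ?_
  have hint : ∀ k, Integrable (fun q : (Metric.sphere (0 : EuclideanSpace ℝ (Fin d)) 1) ×
      (Metric.sphere (0 : EuclideanSpace ℝ (Fin d)) 1) =>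
      Hker d (u k) (r • (q.2 : EuclideanSpace ℝ (Fin d)), s • (q.1 : EuclideanSpace ℝ (Fin d))))
      ((sphMeasure d).prod (sphMeasure d)) := by
    intro k
    have : Measurable fun q : (Metric.sphere (0 : EuclideanSpace ℝ (Fin d)) 1) ×
      (Metric.sphere (0 : EuclideanSpace ℝ (Fin d)) 1) =>
      (r • (q.2 : EuclideanSpace ℝ (Fin d)), s • (q.1 : EuclideanSpace ℝ (Fin d))) := by fun_prop
    exact Integrable.of_bound ((hmeas k).comp this).aestronglyMeasurable (C k)
      (.of_forall fun q => hC k _)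
  have hG : Gd d N u r s = ∫ η : Metric.sphere (0 : EuclideanSpace ℝ (Fin d)) 1,
      ∫ ξ : Metric.sphere (0 : EuclideanSpace ℝ (Fin d)) 1,
        H (r • (ξ : EuclideanSpace ℝ (Fin d)), s • (η : EuclideanSpace ℝ (Fin d)))
        ∂(sphMeasure d) ∂(sphMeasure d) := by
    have hsum := integrable_finsetSum Finset.univ fun k _ => hint k
    have e := integral_prod _ (hsum.const_mul (N : ℝ)⁻¹)
    simp only [H]
    rw [← e, integral_const_mul, integral_finsetSum _ fun k _ => hint k]
    unfold Gd
    congr 1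
    refine Finset.sum_congr rfl fun k _ => ?_
    rw [integral_prod _ (hint k)]
    rfl
  simp only [hG]
end
end

section
/- The linear functional F : L²(ρ) → ℝ defined by F(ψ) = (1/N) Σ_{i=1}^N ∫_ℝ L_ψ[u_i](x) f_i(x) dx is bounded, with |F(ψ)| ≤ ‖Ḡ‖_{L²(ρ⊗ρ)}^{1/2} · ((1/N) Σ_{i=1}^N ‖f_i‖²_{L²(ℝ)})^{1/2} · ‖ψ‖_{L²(ρ)} for all ψ ∈ L²(ρ). Consequently there exists a unique φ^f ∈ L²(ρ) with ⟨φ^f, ψ⟩_{L²(ρ)} = F(ψ) for all ψ ∈ L²(ρ). -/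
open MeasureTheory Set
open scoped BigOperators RealInnerProductSpace ENNReal

noncomputable section

/-- The 1D data-based integral kernel `G`. -/
def Gker (N : ℕ) (u : Fin N → ℝ → ℝ) (r s : ℝ) : ℝ :=
  (N : ℝ)⁻¹ * ∑ i, ∫ x, (u i (x + r) + u i (x - r) - 2 * u i x) *
    (u i (x + s) + u i (x - s) - 2 * u i x)

/-- The reweighted kernel `Ḡ(r,s) = G(r,s) / (p(r) p(s))`. -/
def Gbar (N : ℕ) (u : Fin N → ℝ → ℝ) (p : ℝ → ℝ) (r s : ℝ) : ℝ :=
  Gker N u r s / (p r * p s)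

/-- The nonlocal operator `L_φ[u]` for `φ ∈ L²(ρ)`, using the canonical representative of `φ`
extended by zero outside `[0,R₀]`. -/
def LopLp (R₀ : ℝ) {ρ : Measure ℝ} (φ : Lp ℝ 2 ρ) (u : ℝ → ℝ) (x : ℝ) : ℝ :=
  ∫ y, (Set.Icc 0 R₀).indicator (φ : ℝ → ℝ) |y - x| * (u y - u x)

theorem cs_aux {α : Type*} [MeasurableSpace α] {μ : Measure α} {f g : α → ℝ}
    (hf : MemLp f 2 μ) (hg : MemLp g 2 μ) :
    |∫ a, f a * g a ∂μ| ≤ Real.sqrt (∫ a, f a ^ 2 ∂μ) * Real.sqrt (∫ a, g a ^ 2 ∂μ) := by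
  have h := integral_mul_norm_le_Lp_mul_Lq (μ := μ) (f := f) (g := g)
    (p := 2) (q := 2) ⟨by norm_num, by norm_num, by norm_num⟩ (by simpa using hf) (by simpa using hg)
  have h1 : |∫ a, f a * g a ∂μ| ≤ ∫ a, ‖f a‖ * ‖g a‖ ∂μ := by
    have := norm_integral_le_integral_norm (μ := μ) (fun a => f a * g a)
    simpa [norm_mul] using this
  refine h1.trans (h.trans (le_of_eq ?_))
  simp only [Real.sqrt_eq_rpow]
  congr 2 <;> simp [Real.norm_eq_abs]

theorem norm_Lp_sq {μ : Measure ℝ} (ψ : Lp ℝ 2 μ) : ∫ x, (ψ : ℝ → ℝ) x ^ 2 ∂μ = ‖ψ‖ ^ 2 := by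
  rw [← real_inner_self_eq_norm_sq, L2.inner_def]
  congr 1; ext x; simp [pow_two]

section abs
variable {ρ : Measure ℝ} [IsProbabilityMeasure ρ]

theorem psi_int (ψ : Lp ℝ 2 ρ) : Integrable (ψ : ℝ → ℝ) ρ :=
  (Lp.memLp ψ).integrable (by norm_num)

theorem psiK_int (ψ : Lp ℝ 2 ρ) {K : ℝ → ℝ → ℝ} (hK : Continuous (Function.uncurry K))
    {b : ℝ → ℝ} (hKb : ∀ x r, |K x r| ≤ b x) (x : ℝ) :
    Integrable (fun r => (ψ : ℝ → ℝ) r * K x r) ρ := by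
  have := (psi_int ψ).bdd_mul (f := K x) (c := b x)
    (by have : Continuous (K x) := by fun_prop
        exact this.aestronglyMeasurable) (Filter.Eventually.of_forall (hKb x))
  simpa [mul_comm] using this

theorem L_memLp (ψ : Lp ℝ 2 ρ) {K : ℝ → ℝ → ℝ} (hK : Continuous (Function.uncurry K))
    {b : ℝ → ℝ} (hb : MemLp b 2 volume) (hKb : ∀ x r, |K x r| ≤ b x) :
    MemLp (fun x => ∫ r, (ψ : ℝ → ℝ) r * K x r ∂ρ) 2 volume := by
  have hb' : MemLp (fun x => (∫ r, |(ψ : ℝ → ℝ) r| ∂ρ) * b x) 2 volume := hb.const_mul _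
  refine hb'.mono ?_ ?_
  · have hs : StronglyMeasurable (Function.uncurry fun x r => (ψ : ℝ → ℝ) r * K x r) := by
      refine StronglyMeasurable.mul ?_ hK.stronglyMeasurable
      exact (Lp.stronglyMeasurable ψ).comp_measurable measurable_snd
    exact hs.integral_prod_right.aestronglyMeasurable
  · refine Filter.Eventually.of_forall fun x => ?_
    have hbx : 0 ≤ b x := (abs_nonneg _).trans (hKb x 0)
    refine (norm_integral_le_integral_norm _).trans ?_
    refine le_trans ?_ (le_abs_self _)
    rw [← integral_mul_const]
    refine integral_mono (psiK_int ψ hK hKb x).norm ((psi_int ψ).abs.mul_const _) fun r => ?_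
    simp only [norm_mul, Real.norm_eq_abs]
    exact mul_le_mul_of_nonneg_left (hKb x r) (abs_nonneg _)

theorem triple_int (ψ : Lp ℝ 2 ρ) {K : ℝ → ℝ → ℝ} (hK : Continuous (Function.uncurry K))
    {b : ℝ → ℝ} (hb : MemLp b 2 volume) (hKb : ∀ x r, |K x r| ≤ b x) :
    Integrable (Function.uncurry fun (x : ℝ) (z : ℝ × ℝ) =>
      ((ψ : ℝ → ℝ) z.1 * K x z.1) * ((ψ : ℝ → ℝ) z.2 * K x z.2)) (volume.prod (ρ.prod ρ)) := by
  have h1 : Integrable (fun w : ℝ × (ℝ × ℝ) => (b w.1 ^ 2) * ((ψ : ℝ → ℝ) w.2.1 * (ψ : ℝ → ℝ) w.2.2))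
      (volume.prod (ρ.prod ρ)) :=
    (hb.integrable_sq).mul_prod ((psi_int ψ).mul_prod (psi_int ψ))
  refine h1.mono ?_ (Filter.Eventually.of_forall ?_)
  · refine StronglyMeasurable.aestronglyMeasurable ?_
    have hψ := Lp.stronglyMeasurable ψ
    refine StronglyMeasurable.mul (StronglyMeasurable.mul ?_ ?_) (StronglyMeasurable.mul ?_ ?_)
    · exact hψ.comp_measurable (measurable_fst.comp measurable_snd)
    · have : Continuous fun w : ℝ × (ℝ × ℝ) => K w.1 w.2.1 := by fun_prop
      exact this.stronglyMeasurable
    · exact hψ.comp_measurable (measurable_snd.comp measurable_snd)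
    · have : Continuous fun w : ℝ × (ℝ × ℝ) => K w.1 w.2.2 := by fun_prop
      exact this.stronglyMeasurable
  · rintro ⟨x, r, s⟩
    simp only [Function.uncurry, norm_mul, norm_pow, Real.norm_eq_abs]
    have hbx : 0 ≤ b x := (abs_nonneg _).trans (hKb x 0)
    rw [abs_of_nonneg hbx]
    have := mul_le_mul (hKb x r) (hKb x s) (abs_nonneg _) hbx
    have h0 : 0 ≤ |(ψ : ℝ → ℝ) r| * |(ψ : ℝ → ℝ) s| := by positivity
    nlinarith [mul_le_mul_of_nonneg_left this h0]

theorem L_sq (ψ : Lp ℝ 2 ρ) {K : ℝ → ℝ → ℝ} (hK : Continuous (Function.uncurry K))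
    {b : ℝ → ℝ} (hb : MemLp b 2 volume) (hKb : ∀ x r, |K x r| ≤ b x) :
    Integrable (fun z : ℝ × ℝ => ((ψ : ℝ → ℝ) z.1 * (ψ : ℝ → ℝ) z.2) * ∫ x, K x z.1 * K x z.2)
      (ρ.prod ρ) ∧
    ∫ x, (∫ r, (ψ : ℝ → ℝ) r * K x r ∂ρ) ^ 2 =
      ∫ z : ℝ × ℝ, ((ψ : ℝ → ℝ) z.1 * (ψ : ℝ → ℝ) z.2) * (∫ x, K x z.1 * K x z.2) ∂(ρ.prod ρ) := by
  have ht := triple_int ψ hK hb hKb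
  have e : ∀ z : ℝ × ℝ, ∫ x, ((ψ : ℝ → ℝ) z.1 * K x z.1) * ((ψ : ℝ → ℝ) z.2 * K x z.2) =
      ((ψ : ℝ → ℝ) z.1 * (ψ : ℝ → ℝ) z.2) * ∫ x, K x z.1 * K x z.2 := by
    intro z
    rw [← integral_const_mul]
    congr 1; ext x; ring
  constructor
  · have := ht.integral_prod_right
    simp only [Function.uncurry] at this
    simpa only [e] using this
  · simp_rw [← e]
    rw [← integral_integral_swap ht]
    congr 1; ext x
    rw [integral_prod_mul (fun r => (ψ : ℝ → ℝ) r * K x r) (fun r => (ψ : ℝ → ℝ) r * K x r), pow_two]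

theorem abstract_bound (N : ℕ) (K : Fin N → ℝ → ℝ → ℝ)
    (hK : ∀ i, Continuous (Function.uncurry (K i)))
    (b : Fin N → ℝ → ℝ) (hb : ∀ i, MemLp (b i) 2 volume) (hKb : ∀ i x r, |K i x r| ≤ b i x)
    (f : Fin N → Lp ℝ 2 (volume : Measure ℝ)) (ψ : Lp ℝ 2 ρ) :
    |(N : ℝ)⁻¹ * ∑ i, ∫ x, (∫ r, (ψ : ℝ → ℝ) r * K i x r ∂ρ) * (f i : ℝ → ℝ) x|
        ≤ Real.sqrt (Real.sqrt
            (∫ r, ∫ s, ((N : ℝ)⁻¹ * ∑ i, ∫ x, K i x r * K i x s) ^ 2 ∂ρ ∂ρ)) *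
          Real.sqrt ((N : ℝ)⁻¹ * ∑ i, ∫ x, ((f i : ℝ → ℝ) x) ^ 2) * ‖ψ‖ := by
  set G : ℝ × ℝ → ℝ := fun z => (N : ℝ)⁻¹ * ∑ i, ∫ x, K i x z.1 * K i x z.2 with hG
  set A : Fin N → ℝ := fun i => ∫ x, (∫ r, (ψ : ℝ → ℝ) r * K i x r ∂ρ) ^ 2 with hA
  set B : Fin N → ℝ := fun i => ∫ x, ((f i : ℝ → ℝ) x) ^ 2 with hB
  have hA0 : ∀ i, 0 ≤ A i := fun i => integral_nonneg fun x => sq_nonneg _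
  have hB0 : ∀ i, 0 ≤ B i := fun i => integral_nonneg fun x => sq_nonneg _
  have hN0 : (0:ℝ) ≤ (N : ℝ)⁻¹ := by positivity
  -- G is in L2
  have hGm : StronglyMeasurable G := by
    refine stronglyMeasurable_const.mul ?_
    refine Finset.stronglyMeasurable_fun_sum _ fun i _ => ?_
    have hc : Continuous (Function.uncurry fun (z : ℝ × ℝ) (x : ℝ) => K i x z.1 * K i x z.2) := by
      have := hK i
      unfold Function.uncurry
      fun_prop
    exact hc.stronglyMeasurable.integral_prod_right
  have hGb : ∀ z, ‖G z‖ ≤ (N : ℝ)⁻¹ * ∑ i, ∫ x, b i x ^ 2 := by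
    intro z
    simp only [hG, norm_mul, Real.norm_eq_abs, abs_of_nonneg hN0]
    refine mul_le_mul_of_nonneg_left ?_ hN0
    refine (Finset.abs_sum_le_sum_abs _ _).trans (Finset.sum_le_sum fun i _ => ?_)
    rw [← Real.norm_eq_abs]
    refine norm_integral_le_of_norm_le (hb i).integrable_sq (Filter.Eventually.of_forall fun x => ?_)
    simp only [norm_mul, Real.norm_eq_abs, pow_two]
    have hbx : 0 ≤ b i x := (abs_nonneg _).trans (hKb i x 0)
    exact mul_le_mul (hKb i x _) (hKb i x _) (abs_nonneg _) hbx
  have hG2 : MemLp G 2 (ρ.prod ρ) :=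
    MemLp.of_bound hGm.aestronglyMeasurable _ (Filter.Eventually.of_forall hGb)
  have hψsq := (Lp.memLp ψ).integrable_sq
  have hψ2 : MemLp (fun z : ℝ × ℝ => (ψ : ℝ → ℝ) z.1 * (ψ : ℝ → ℝ) z.2) 2 (ρ.prod ρ) := by
    rw [memLp_two_iff_integrable_sq]
    · simp only [mul_pow]
      exact hψsq.mul_prod hψsq
    · have hψ := Lp.stronglyMeasurable ψ
      exact ((hψ.comp_measurable measurable_fst).mul
        (hψ.comp_measurable measurable_snd)).aestronglyMeasurable
  have hAG : (N : ℝ)⁻¹ * ∑ i, A i =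
      ∫ z, ((ψ : ℝ → ℝ) z.1 * (ψ : ℝ → ℝ) z.2) * G z ∂(ρ.prod ρ) := by
    simp only [hA, hG]
    rw [Finset.sum_congr rfl fun i _ => (L_sq ψ (hK i) (hb i) (hKb i)).2,
      ← integral_finsetSum _ fun i _ => (L_sq ψ (hK i) (hb i) (hKb i)).1, ← integral_const_mul]
    congr 1; ext z
    rw [← Finset.mul_sum]; ring
  have hGsq : ∫ r, ∫ s, ((N : ℝ)⁻¹ * ∑ i, ∫ x, K i x r * K i x s) ^ 2 ∂ρ ∂ρ =
      ∫ z, G z ^ 2 ∂(ρ.prod ρ) := (integral_prod _ hG2.integrable_sq).symm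
  have hAle : (N : ℝ)⁻¹ * ∑ i, A i ≤ ‖ψ‖ ^ 2 * Real.sqrt (∫ z, G z ^ 2 ∂(ρ.prod ρ)) := by
    rw [hAG]
    refine (le_abs_self _).trans ((cs_aux hψ2 hG2).trans (le_of_eq ?_))
    congr 1
    simp only [mul_pow]
    rw [integral_prod_mul (fun r => (ψ : ℝ → ℝ) r ^ 2) (fun r => (ψ : ℝ → ℝ) r ^ 2), norm_Lp_sq,
      Real.sqrt_mul_self (by positivity)]
  rw [hGsq]
  have hmain : |(N : ℝ)⁻¹ * ∑ i, ∫ x, (∫ r, (ψ : ℝ → ℝ) r * K i x r ∂ρ) * (f i : ℝ → ℝ) x| ≤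
      Real.sqrt ((N : ℝ)⁻¹ * ∑ i, A i) * Real.sqrt ((N : ℝ)⁻¹ * ∑ i, B i) := by
    rw [abs_mul, abs_of_nonneg hN0]
    have h1 : |∑ i, ∫ x, (∫ r, (ψ : ℝ → ℝ) r * K i x r ∂ρ) * (f i : ℝ → ℝ) x| ≤
        ∑ i, Real.sqrt (A i) * Real.sqrt (B i) :=
      (Finset.abs_sum_le_sum_abs _ _).trans (Finset.sum_le_sum fun i _ =>
        cs_aux (L_memLp ψ (hK i) (hb i) (hKb i)) (Lp.memLp (f i)))
    have h2 := Real.sum_mul_le_sqrt_mul_sqrt Finset.univ (fun i => Real.sqrt (A i))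
      (fun i => Real.sqrt (B i))
    simp only [Real.sq_sqrt (hA0 _), Real.sq_sqrt (hB0 _)] at h2
    rw [Real.sqrt_mul hN0, Real.sqrt_mul hN0]
    calc _ ≤ (N : ℝ)⁻¹ * (√(∑ i, A i) * √(∑ i, B i)) :=
          mul_le_mul_of_nonneg_left (h1.trans h2) hN0
      _ = (√(N : ℝ)⁻¹ * √(N : ℝ)⁻¹) * (√(∑ i, A i) * √(∑ i, B i)) := by
          rw [Real.mul_self_sqrt hN0]
      _ = _ := by ring
  refine hmain.trans ?_
  have h3 : Real.sqrt ((N : ℝ)⁻¹ * ∑ i, A i) ≤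
      ‖ψ‖ * Real.sqrt (Real.sqrt (∫ z, G z ^ 2 ∂(ρ.prod ρ))) := by
    refine (Real.sqrt_le_sqrt hAle).trans (le_of_eq ?_)
    rw [Real.sqrt_mul (by positivity), Real.sqrt_sq (norm_nonneg _)]
  calc _ ≤ (‖ψ‖ * Real.sqrt (Real.sqrt (∫ z, G z ^ 2 ∂(ρ.prod ρ)))) *
        Real.sqrt ((N : ℝ)⁻¹ * ∑ i, B i) := mul_le_mul_of_nonneg_right h3 (Real.sqrt_nonneg _)
    _ = _ := by ring

theorem abstract_riesz (N : ℕ) (K : Fin N → ℝ → ℝ → ℝ)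
    (hK : ∀ i, Continuous (Function.uncurry (K i)))
    (b : Fin N → ℝ → ℝ) (hb : ∀ i, MemLp (b i) 2 volume) (hKb : ∀ i x r, |K i x r| ≤ b i x)
    (f : Fin N → Lp ℝ 2 (volume : Measure ℝ)) :
    ∃! φf : Lp ℝ 2 ρ, ∀ ψ : Lp ℝ 2 ρ, ⟪φf, ψ⟫ =
      (N : ℝ)⁻¹ * ∑ i, ∫ x, (∫ r, (ψ : ℝ → ℝ) r * K i x r ∂ρ) * (f i : ℝ → ℝ) x := by
  have hadd : ∀ (ψ φ : Lp ℝ 2 ρ) i x, ∫ r, ((ψ + φ : Lp ℝ 2 ρ) : ℝ → ℝ) r * K i x r ∂ρ =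
      (∫ r, (ψ : ℝ → ℝ) r * K i x r ∂ρ) + ∫ r, (φ : ℝ → ℝ) r * K i x r ∂ρ := by
    intro ψ φ i x
    rw [← integral_add (psiK_int ψ (hK i) (hKb i) x) (psiK_int φ (hK i) (hKb i) x)]
    refine integral_congr_ae ?_
    filter_upwards [Lp.coeFn_add ψ φ] with r hr
    rw [hr, Pi.add_apply]; ring
  have hsmul : ∀ (c : ℝ) (ψ : Lp ℝ 2 ρ) i x, ∫ r, ((c • ψ : Lp ℝ 2 ρ) : ℝ → ℝ) r * K i x r ∂ρ =
      c * (∫ r, (ψ : ℝ → ℝ) r * K i x r ∂ρ) := by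
    intro c ψ i x
    rw [← integral_const_mul]
    refine integral_congr_ae ?_
    filter_upwards [Lp.coeFn_smul c ψ] with r hr
    rw [hr, Pi.smul_apply, smul_eq_mul]; ring
  let F : Lp ℝ 2 ρ →ₗ[ℝ] ℝ :=
    { toFun := fun ψ =>
        (N : ℝ)⁻¹ * ∑ i, ∫ x, (∫ r, (ψ : ℝ → ℝ) r * K i x r ∂ρ) * (f i : ℝ → ℝ) x
      map_add' := by
        intro ψ φ
        simp only [hadd]
        rw [← mul_add, ← Finset.sum_add_distrib]
        congr 1
        refine Finset.sum_congr rfl fun i _ => ?_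
        rw [← integral_add]
        · simp only [add_mul]
        · exact (L_memLp ψ (hK i) (hb i) (hKb i)).integrable_mul (Lp.memLp (f i))
        · exact (L_memLp φ (hK i) (hb i) (hKb i)).integrable_mul (Lp.memLp (f i))
      map_smul' := by
        intro c ψ
        simp only [hsmul, mul_assoc, integral_const_mul, ← Finset.mul_sum, RingHom.id_apply,
          smul_eq_mul]
        ring }
  let F' : StrongDual ℝ (Lp ℝ 2 ρ) := F.mkContinuous _ (fun ψ => abstract_bound N K hK b hb hKb f ψ)
  refine ⟨(InnerProductSpace.toDual ℝ _).symm F', fun ψ => ?_, fun φ hφ => ?_⟩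
  · rw [InnerProductSpace.toDual_symm_apply]; rfl
  · refine ext_inner_right ℝ fun ψ => ?_
    rw [InnerProductSpace.toDual_symm_apply]
    exact hφ ψ
end abs

theorem integrable_abs_comp {h : ℝ → ℝ} (hh : Integrable h) : Integrable fun y : ℝ => h |y| := by
  rw [← integrableOn_univ, ← Iic_union_Ioi (a := (0:ℝ))]
  refine IntegrableOn.union ?_ ?_
  · have h1 : IntegrableOn (fun y => h (-y)) (Iic 0) := (hh.comp_neg).integrableOn
    exact h1.congr_fun (fun y hy => by simp only [abs_of_nonpos (mem_Iic.1 hy)]) measurableSet_Iic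
  · have h1 : IntegrableOn h (Ioi 0) := hh.integrableOn
    exact h1.congr_fun (fun y hy => by simp only [abs_of_pos (mem_Ioi.1 hy)]) measurableSet_Ioi

theorem Lop_split {R₀ : ℝ} {ψ v : ℝ → ℝ} (hψ : IntegrableOn ψ (Icc 0 R₀)) (hv : Continuous v)
    (C : ℝ) (hC : ∀ x, |v x| ≤ C) (x : ℝ) :
    ∫ y, (Set.Icc 0 R₀).indicator ψ |y - x| * (v y - v x) =
      ∫ r in Icc 0 R₀, ψ r * (v (x + r) + v (x - r) - 2 * v x) := by
  set h := (Set.Icc 0 R₀).indicator ψ with hh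
  have hi : Integrable h := (integrable_indicator_iff measurableSet_Icc).2 hψ
  have hia := integrable_abs_comp hi
  set g : ℝ → ℝ := fun z => h |z| * (v (z + x) - v x) with hg
  have hgi : Integrable g := by
    have := hia.bdd_mul (f := fun z => v (z + x) - v x) (c := C + C)
      (by have : Continuous fun z => v (z + x) - v x := by fun_prop
          exact this.aestronglyMeasurable)
      (Filter.Eventually.of_forall fun z =>
        (abs_sub _ _).trans (add_le_add (hC _) (hC _)))
    simpa [hg, mul_comm] using this
  have e1 : ∫ y, h |y - x| * (v y - v x) = ∫ z, g z := by
    rw [← integral_sub_right_eq_self g x]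
    simp [hg]
  have e2 : ∫ z, g z = (∫ z in Ioi 0, g (-z)) + ∫ z in Ioi 0, g z := by
    rw [integral_comp_neg_Ioi, neg_zero,
      intervalIntegral.integral_Iic_add_Ioi hgi.integrableOn hgi.integrableOn]
  rw [e1, e2, ← integral_add hgi.comp_neg.integrableOn hgi.integrableOn]
  have e3 : ∀ z ∈ Ioi (0:ℝ), g (-z) + g z =
      (Icc 0 R₀).indicator (fun r => ψ r * (v (x + r) + v (x - r) - 2 * v x)) z := by
    intro z hz
    simp only [hg, abs_neg, abs_of_pos (mem_Ioi.1 hz), hh]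
    by_cases hz' : z ∈ Icc 0 R₀
    · simp only [indicator_of_mem hz']
      rw [show -z + x = x - z by ring, show z + x = x + z by ring]; ring
    · simp [indicator_of_notMem hz']
  rw [setIntegral_congr_fun measurableSet_Ioi e3, ← integral_Ici_eq_integral_Ioi,
    setIntegral_indicator measurableSet_Icc]
  congr 2
  exact inter_eq_right.2 Icc_subset_Ici_self

theorem Lop_eq (R₀ : ℝ) (v : ℝ → ℝ) (hv : Continuous v) (C : ℝ) (hC : ∀ x, |v x| ≤ C)
    (p : ℝ → ℝ) (hpc : ContinuousOn p (Set.Icc 0 R₀)) (hpp : ∀ r ∈ Set.Icc 0 R₀, 0 < p r)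
    (ρ : Measure ℝ) [IsProbabilityMeasure ρ]
    (hρ : ρ = (volume.restrict (Set.Icc 0 R₀)).withDensity fun r => ENNReal.ofReal (p r))
    (ψ : Lp ℝ 2 ρ) (K : ℝ → ℝ → ℝ)
    (hK : ∀ x, ∀ r ∈ Icc 0 R₀, K x r = (v (x + r) + v (x - r) - 2 * v x) / p r) (x : ℝ) :
    LopLp R₀ ψ v x = ∫ r, (ψ : ℝ → ℝ) r * K x r ∂ρ := by
  have hpm : AEMeasurable p (volume.restrict (Icc 0 R₀)) := hpc.aemeasurable measurableSet_Icc
  have hint := psi_int ψ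
  set w : ℝ → ℝ := (ψ : ℝ → ℝ) with hw
  clear_value w
  have hm : IntegrableOn (fun r => p r * w r) (Icc 0 R₀) := by
    rw [hρ, integrable_withDensity_iff_integrable_smul₀' hpm.ennreal_ofReal
      (Filter.Eventually.of_forall fun _ => ENNReal.ofReal_lt_top)] at hint
    refine IntegrableOn.congr_fun hint (fun r hr => ?_) measurableSet_Icc
    simp [ENNReal.toReal_ofReal (hpp r hr).le]
  have hψ : IntegrableOn w (Icc 0 R₀) := by
    have hinv : ContinuousOn (fun r => (p r)⁻¹) (Icc 0 R₀) :=
      hpc.inv₀ fun r hr => (hpp r hr).ne'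
    have := hm.continuousOn_mul hinv isCompact_Icc
    refine IntegrableOn.congr_fun this (fun r hr => ?_) measurableSet_Icc
    have := (hpp r hr).ne'
    field_simp
  unfold LopLp
  rw [← hw, Lop_split hψ hv C hC x, hρ]
  have h0 := integral_withDensity_eq_integral_smul₀ (hpm.real_toNNReal) (fun r => w r * K x r)
  refine Eq.trans ?_ h0.symm
  refine setIntegral_congr_fun measurableSet_Icc fun r hr => ?_
  have := (hpp r hr).ne'
  simp only [NNReal.smul_def, Real.coe_toNNReal _ (hpp r hr).le, hK x r hr, smul_eq_mul]
  field_simp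

/-- The linear functional `F(ψ) = (1/N) Σ_i ∫ L_ψ[u_i] f_i` is bounded on `L²(ρ)` with the
Cauchy–Schwarz bound, and hence admits a unique Riesz representative `φ^f ∈ L²(ρ)`. -/
theorem riesz_representative_exists (R₀ : ℝ) (hR₀ : 0 < R₀)
    (N : ℕ) (hN : 0 < N) (u : Fin N → ℝ → ℝ)
    (hu : ∀ i, Continuous (u i)) (hcs : ∀ i, HasCompactSupport (u i))
    (f : Fin N → Lp ℝ 2 (volume : Measure ℝ))
    (p : ℝ → ℝ) (hpc : ContinuousOn p (Set.Icc 0 R₀)) (hpp : ∀ r ∈ Set.Icc 0 R₀, 0 < p r)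
    (ρ : Measure ℝ) [IsProbabilityMeasure ρ]
    (hρ : ρ = (volume.restrict (Set.Icc 0 R₀)).withDensity fun r => ENNReal.ofReal (p r)) :
    (∀ ψ : Lp ℝ 2 ρ,
      |(N : ℝ)⁻¹ * ∑ i, ∫ x, LopLp R₀ ψ (u i) x * (f i : ℝ → ℝ) x|
        ≤ Real.sqrt (Real.sqrt (∫ r, ∫ s, (Gbar N u p r s) ^ 2 ∂ρ ∂ρ)) *
          Real.sqrt ((N : ℝ)⁻¹ * ∑ i, ∫ x, ((f i : ℝ → ℝ) x) ^ 2) * ‖ψ‖) ∧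
    (∃! φf : Lp ℝ 2 ρ, ∀ ψ : Lp ℝ 2 ρ,
      ⟪φf, ψ⟫ = (N : ℝ)⁻¹ * ∑ i, ∫ x, LopLp R₀ ψ (u i) x * (f i : ℝ → ℝ) x) := by
  have hex : ∀ i, ∃ K : ℝ → ℝ → ℝ, ∃ b : ℝ → ℝ, Continuous (Function.uncurry K) ∧
      MemLp b 2 volume ∧ (∀ x r, |K x r| ≤ b x) ∧ (∃ C, ∀ x, |u i x| ≤ C) ∧
      ∀ x, ∀ r ∈ Icc 0 R₀, K x r = (u i (x + r) + u i (x - r) - 2 * u i x) / p r := by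
    intro i
    obtain ⟨C, hC⟩ := (hu i).bounded_above_of_compact_support (hcs i)
    have hC0 : 0 ≤ C := (norm_nonneg _).trans (hC 0)
    obtain ⟨B, hB⟩ := (hcs i).isCompact.isBounded.exists_norm_le
    have hB' : ∀ x, B < |x| → u i x = 0 := by
      intro x hx
      by_contra h
      exact absurd (hB x (subset_tsupport _ h)) (not_le.2 hx)
    set P : ℝ → ℝ := fun r => (projIcc 0 R₀ hR₀.le r : ℝ) with hP
    have hPc : Continuous P := continuous_subtype_val.comp continuous_projIcc
    have hPm : ∀ r, P r ∈ Icc 0 R₀ := fun r => (projIcc 0 R₀ hR₀.le r).2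
    have hPi : ∀ r ∈ Icc 0 R₀, P r = r := fun r hr => by simp [hP, projIcc_of_mem hR₀.le hr]
    have hpP : Continuous fun r => p (P r) := hpc.comp_continuous hPc hPm
    have hinv : ContinuousOn (fun r => (p r)⁻¹) (Icc 0 R₀) :=
      hpc.inv₀ fun r hr => (hpp r hr).ne'
    obtain ⟨D, hD⟩ := isCompact_Icc.exists_bound_of_continuousOn hinv
    have hD0 : 0 ≤ D := (norm_nonneg _).trans (hD 0 ⟨le_rfl, hR₀.le⟩)
    have huc := hu i
    refine ⟨fun x r => (u i (x + P r) + u i (x - P r) - 2 * u i x) / p (P r),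
      (Icc (-(B + R₀)) (B + R₀)).indicator fun _ => 4 * C * D, ?_, ?_, ?_, ⟨C, hC⟩, ?_⟩
    · unfold Function.uncurry
      refine Continuous.div ?_ (hpP.comp continuous_snd) fun z => (hpp _ (hPm _)).ne'
      fun_prop
    · exact memLp_indicator_const 2 measurableSet_Icc _ (Or.inr measure_Icc_lt_top.ne)
    · intro x r
      beta_reduce
      by_cases hx : x ∈ Icc (-(B + R₀)) (B + R₀)
      · rw [indicator_of_mem hx, div_eq_mul_inv, abs_mul]
        refine mul_le_mul ?_ (hD _ (hPm r)) (abs_nonneg _) (by positivity)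
        have h1 := abs_le.1 (hC (x + P r))
        have h2 := abs_le.1 (hC (x - P r))
        have h3 := abs_le.1 (hC x)
        rw [abs_le]
        constructor <;> linarith [h1.1, h1.2, h2.1, h2.2, h3.1, h3.2]
      · rw [indicator_of_notMem hx]
        have hr := hPm r
        have hx' : B + R₀ < |x| := by
          by_contra h
          exact hx (abs_le.1 (not_lt.1 h))
        have h1 : B < |x| := by linarith
        have hPr : |P r| ≤ R₀ := by rw [abs_of_nonneg hr.1]; exact hr.2
        have h2 : B < |x + P r| := by
          have := abs_sub (x + P r) (P r)
          rw [add_sub_cancel_right] at this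
          linarith
        have h3 : B < |x - P r| := by
          have := abs_add_le (x - P r) (P r)
          rw [sub_add_cancel] at this
          linarith
        simp [hB' _ h1, hB' _ h2, hB' _ h3]
    · intro x r hr
      simp only [hPi r hr]
  choose K b hK hb hKb hbd hKe using hex
  have hL : ∀ (ψ : Lp ℝ 2 ρ) i x, LopLp R₀ ψ (u i) x = ∫ r, (ψ : ℝ → ℝ) r * K i x r ∂ρ := by
    intro ψ i x
    obtain ⟨C, hC⟩ := hbd i
    exact Lop_eq R₀ (u i) (hu i) C hC p hpc hpp ρ hρ ψ (K i) (hKe i) x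
  have hae : ∀ᵐ r ∂ρ, r ∈ Icc 0 R₀ := by
    have h1 : ∀ᵐ r ∂(volume.restrict (Icc 0 R₀)), r ∈ Icc 0 R₀ := ae_restrict_mem measurableSet_Icc
    rw [hρ]
    exact (withDensity_absolutelyContinuous _ _).ae_le h1
  have hGe : ∫ r, ∫ s, (Gbar N u p r s) ^ 2 ∂ρ ∂ρ =
      ∫ r, ∫ s, ((N : ℝ)⁻¹ * ∑ i, ∫ x, K i x r * K i x s) ^ 2 ∂ρ ∂ρ := by
    refine integral_congr_ae ?_
    filter_upwards [hae] with r hr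
    refine integral_congr_ae ?_
    filter_upwards [hae] with s hs
    congr 1
    unfold Gbar Gker
    rw [mul_div_assoc, Finset.sum_div]
    congr 1
    refine Finset.sum_congr rfl fun i _ => ?_
    rw [← integral_div]
    congr 1; ext x
    rw [hKe i x r hr, hKe i x s hs, div_mul_div_comm]
  simp only [hL, hGe]
  exact ⟨abstract_bound N K hK b hb hKb f, abstract_riesz N K hK b hb hKb f⟩
end
end

section
/- For every φ ∈ L²(ρ), E(φ) = ⟨L_Ḡ φ, φ⟩_{L²(ρ)} − 2⟨φ^f, φ⟩_{L²(ρ)} + (1/N) Σ_{i=1}^N ‖f_i‖²_{L²(ℝ)}. -/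
open MeasureTheory Set
open scoped BigOperators RealInnerProductSpace ENNReal

noncomputable section

/-- The loss functional `E(φ) = (1/N) Σ_i ‖L_φ[u_i] - f_i‖²_{L²(ℝ)}`. -/
def lossE (R₀ : ℝ) {ρ : Measure ℝ} (N : ℕ) (u : Fin N → ℝ → ℝ) (f : Fin N → ℝ → ℝ)
    (φ : Lp ℝ 2 ρ) : ℝ :=
  (N : ℝ)⁻¹ * ∑ i, ∫ x, (LopLp R₀ φ (u i) x - f i x) ^ 2

/-- Symmetric second difference. -/
def secDiff (u : ℝ → ℝ) (x r : ℝ) : ℝ := u (x + r) + u (x - r) - 2 * u x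

theorem integrable_comp_abs_aux {g : ℝ → ℝ} (hgm : StronglyMeasurable g) (hg : Integrable g) :
    Integrable (fun z => g |z|) := by
  refine Integrable.mono' (hg.norm.add hg.comp_neg.norm)
    (hgm.comp_measurable measurable_abs).aestronglyMeasurable ?_
  filter_upwards with z
  rcases abs_choice z with h | h <;> rw [h] <;> simp

theorem lop_eq {R : ℝ} {g u : ℝ → ℝ} (hgm : StronglyMeasurable g) (hg : Integrable g)
    (hg0 : ∀ r, r ∉ Set.Icc 0 R → g r = 0) (hu : Continuous u) {M : ℝ} (hM : ∀ x, ‖u x‖ ≤ M)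
    (x : ℝ) :
    ∫ y, g |y - x| * (u y - u x) = ∫ r, g r * secDiff u x r := by
  set h : ℝ → ℝ := fun z => g |z| * (u (x + z) - u x) with hh
  have hIntg : Integrable h := by
    refine (integrable_comp_abs_aux hgm hg).mul_bdd (c := M + M) ?_ ?_
    · exact (by fun_prop : Continuous fun z => u (x + z) - u x).aestronglyMeasurable
    · filter_upwards with z
      exact (norm_sub_le _ _).trans (add_le_add (hM _) (hM _))
  have e1 : ∫ y, g |y - x| * (u y - u x) = ∫ z, h z := by
    rw [← integral_sub_right_eq_self h x]
    simp [hh]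
  have e2 : ∫ z, h z = ∫ z, h (-z) := (integral_neg_eq_self h volume).symm
  have e3 : (∫ z, h z) + ∫ z, h (-z) = ∫ z, (fun r => g r * secDiff u x r) |z| := by
    rw [← integral_add hIntg hIntg.comp_neg]
    congr 1
    ext z
    simp only [hh, secDiff, abs_neg]
    rcases abs_choice z with h | h <;> rw [h] <;> simp only [sub_neg_eq_add, ← sub_eq_add_neg] <;> ring
  have e4 : ∫ r in Ioi (0:ℝ), g r * secDiff u x r = ∫ r, g r * secDiff u x r := by
    rw [← integral_Ici_eq_integral_Ioi]
    apply setIntegral_eq_integral_of_forall_compl_eq_zero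
    intro r hr
    rw [hg0 r (fun h => hr h.1), zero_mul]
  rw [integral_comp_abs (f := fun r => g r * secDiff u x r), e4] at e3
  rw [e1]
  linarith

theorem sdiff_bound {u : ℝ → ℝ} (hu : Continuous u) (hc : HasCompactSupport u) (R : ℝ) :
    ∃ W : ℝ → ℝ, (∀ x, 0 ≤ W x) ∧ Integrable W ∧ MemLp W 2 volume ∧ Integrable (fun x => W x * W x) ∧
      ∀ x, ∀ r ∈ Set.Icc 0 R, ‖secDiff u x r‖ ≤ W x := by
  obtain ⟨M, hM⟩ := hc.exists_bound_of_continuous hu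
  obtain ⟨B, hB⟩ := hc.isCompact.isBounded.subset_closedBall (0:ℝ)
  have hM0 : 0 ≤ M := (norm_nonneg _).trans (hM 0)
  have hz : ∀ x, B < |x| → u x = 0 := by
    intro x hx
    by_contra hne
    have := hB (subset_tsupport u hne)
    simp at this
    linarith
  set W : ℝ → ℝ := (Set.Icc (-(B + R)) (B + R)).indicator (fun _ => 4 * M) with hW
  have hL2 : MemLp W 2 volume :=
    memLp_indicator_const 2 measurableSet_Icc _ (Or.inr (by simp))
  refine ⟨W, ?_, ?_, hL2, ?_, ?_⟩
  · intro x
    exact Set.indicator_nonneg (fun _ _ => by positivity) x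
  · exact memLp_one_iff_integrable.1
      (memLp_indicator_const 1 measurableSet_Icc _ (Or.inr (by simp)))
  · exact hL2.integrable_mul hL2
  · intro x r hr
    by_cases hx : x ∈ Set.Icc (-(B + R)) (B + R)
    · rw [hW, Set.indicator_of_mem hx]
      have h1 := abs_le.1 (hM (x + r))
      have h2 := abs_le.1 (hM (x - r))
      have h3 := abs_le.1 (hM x)
      rw [Real.norm_eq_abs, abs_le, secDiff]
      constructor <;> linarith
    · rw [hW, Set.indicator_of_notMem hx]
      have hx' : B + R < |x| := by
        by_contra hcon
        exact hx (abs_le.1 (not_lt.1 hcon))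
      have hr0 := hr.1
      have hrR := hr.2
      have h1 : B < |x + r| := by
        have := abs_sub_abs_le_abs_sub x (-r)
        rw [abs_neg, abs_of_nonneg hr0, sub_neg_eq_add] at this
        linarith
      have h2 : B < |x - r| := by
        have := abs_sub_abs_le_abs_sub x r
        rw [abs_of_nonneg hr0] at this
        linarith
      simp [secDiff, hz _ h1, hz _ h2, hz x (by linarith)]

theorem continuous_sdiff {u : ℝ → ℝ} (hu : Continuous u) :
    Continuous (fun q : ℝ × ℝ => secDiff u q.1 q.2) := by
  unfold secDiff
  fun_prop

theorem memLp_lop {R : ℝ} {g u : ℝ → ℝ} (hgm : StronglyMeasurable g) (hg : Integrable g)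
    (hg0 : ∀ r, r ∉ Set.Icc 0 R → g r = 0) (hu : Continuous u) (hc : HasCompactSupport u) :
    MemLp (fun x => ∫ r, g r * secDiff u x r) 2 volume := by
  obtain ⟨W, hW0, -, hW2, -, hWb⟩ := sdiff_bound hu hc R
  refine (hW2.const_mul (∫ r, ‖g r‖)).of_le ?_ ?_
  · have : StronglyMeasurable (fun q : ℝ × ℝ => g q.2 * secDiff u q.1 q.2) :=
      (hgm.comp_measurable measurable_snd).mul (continuous_sdiff hu).stronglyMeasurable
    exact this.integral_prod_right'.aestronglyMeasurable
  · filter_upwards with x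
    calc ‖∫ r, g r * secDiff u x r‖ ≤ ∫ r, ‖g r‖ * W x := by
          refine norm_integral_le_of_norm_le (hg.norm.mul_const _) ?_
          filter_upwards with r
          rw [norm_mul]
          by_cases hr : r ∈ Set.Icc 0 R
          · exact mul_le_mul_of_nonneg_left (hWb x r hr) (norm_nonneg _)
          · simp [hg0 r hr]
      _ = (∫ r, ‖g r‖) * W x := integral_mul_const _ _
      _ ≤ _ := Real.le_norm_self _

theorem integrable_triple {R : ℝ} {g u : ℝ → ℝ} (hgm : StronglyMeasurable g) (hg : Integrable g)
    (hg0 : ∀ r, r ∉ Set.Icc 0 R → g r = 0) (hu : Continuous u) (hc : HasCompactSupport u) :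
    Integrable (fun z : (ℝ × ℝ) × ℝ =>
      (g z.1.1 * secDiff u z.2 z.1.1) * (g z.1.2 * secDiff u z.2 z.1.2))
      ((volume.prod volume).prod volume) := by
  obtain ⟨W, hW0, -, -, hWW, hWb⟩ := sdiff_bound hu hc R
  have hdom := (hg.norm.mul_prod hg.norm).mul_prod hWW
  refine hdom.mono' ?_ ?_
  · have c1 : Measurable fun z : (ℝ × ℝ) × ℝ => secDiff u z.2 z.1.1 :=
      ((continuous_sdiff hu).comp (by fun_prop : Continuous fun z : (ℝ × ℝ) × ℝ => (z.2, z.1.1))).measurable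
    have c2 : Measurable fun z : (ℝ × ℝ) × ℝ => secDiff u z.2 z.1.2 :=
      ((continuous_sdiff hu).comp (by fun_prop : Continuous fun z : (ℝ × ℝ) × ℝ => (z.2, z.1.2))).measurable
    have hgm' := hgm.measurable
    exact (((hgm'.comp (measurable_fst.comp measurable_fst)).mul c1).mul
      ((hgm'.comp (measurable_snd.comp measurable_fst)).mul c2)).aestronglyMeasurable
  · filter_upwards with z
    have key : ∀ r, ‖g r * secDiff u z.2 r‖ ≤ ‖g r‖ * W z.2 := by
      intro r
      rw [norm_mul]
      by_cases hr : r ∈ Set.Icc 0 R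
      · exact mul_le_mul_of_nonneg_left (hWb _ r hr) (norm_nonneg _)
      · simp [hg0 r hr]
    rw [norm_mul]
    calc _ ≤ (‖g z.1.1‖ * W z.2) * (‖g z.1.2‖ * W z.2) :=
          mul_le_mul (key _) (key _) (norm_nonneg _) (mul_nonneg (norm_nonneg _) (hW0 _))
      _ = _ := by ring

theorem integrable_pair {R : ℝ} {g u : ℝ → ℝ} (hgm : StronglyMeasurable g) (hg : Integrable g)
    (hg0 : ∀ r, r ∉ Set.Icc 0 R → g r = 0) (hu : Continuous u) (hc : HasCompactSupport u) :
    Integrable (fun q : ℝ × ℝ => g q.1 * g q.2 * ∫ x, secDiff u x q.1 * secDiff u x q.2)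
      (volume.prod volume) := by
  have h := (integrable_triple hgm hg hg0 hu hc).integral_prod_left
  refine h.congr ?_
  filter_upwards with q
  rw [← integral_const_mul]
  congr 1
  ext x
  ring

theorem integral_lop_sq {R : ℝ} {g u : ℝ → ℝ} (hgm : StronglyMeasurable g) (hg : Integrable g)
    (hg0 : ∀ r, r ∉ Set.Icc 0 R → g r = 0) (hu : Continuous u) (hc : HasCompactSupport u) :
    ∫ x, (∫ r, g r * secDiff u x r) ^ 2 =
      ∫ q : ℝ × ℝ, (g q.1 * g q.2 * ∫ x, secDiff u x q.1 * secDiff u x q.2) ∂(volume.prod volume) := by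
  have h := integrable_triple hgm hg hg0 hu hc
  have e := integral_integral_swap (f := fun (q : ℝ × ℝ) (x : ℝ) =>
      (g q.1 * secDiff u x q.1) * (g q.2 * secDiff u x q.2)) h
  calc _ = ∫ x, ∫ q : ℝ × ℝ, (g q.1 * secDiff u x q.1) * (g q.2 * secDiff u x q.2)
            ∂(volume.prod volume) := by
        congr 1
        ext x
        rw [sq, ← integral_prod_mul (μ := volume) (ν := volume) (fun r => g r * secDiff u x r)
          (fun r => g r * secDiff u x r)]
    _ = _ := by
        rw [← e]
        congr 1
        ext q
        rw [← integral_const_mul]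
        congr 1
        ext x
        ring

/-- Quadratic expansion of the loss functional:
`E(φ) = ⟨L_Ḡ φ, φ⟩ - 2⟨φ^f, φ⟩ + (1/N) Σ_i ‖f_i‖²`. -/
theorem loss_quadratic_expansion (R₀ : ℝ) (hR₀ : 0 < R₀)
    (N : ℕ) (hN : 0 < N) (u : Fin N → ℝ → ℝ)
    (hu : ∀ i, Continuous (u i)) (hcs : ∀ i, HasCompactSupport (u i))
    (f : Fin N → Lp ℝ 2 (volume : Measure ℝ))
    (p : ℝ → ℝ) (hpc : ContinuousOn p (Set.Icc 0 R₀)) (hpp : ∀ r ∈ Set.Icc 0 R₀, 0 < p r)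
    (ρ : Measure ℝ) [IsProbabilityMeasure ρ]
    (hρ : ρ = (volume.restrict (Set.Icc 0 R₀)).withDensity fun r => ENNReal.ofReal (p r))
    (φ : Lp ℝ 2 ρ) (Tφ : Lp ℝ 2 ρ)
    (hTφ : (Tφ : ℝ → ℝ) =ᵐ[ρ] fun r => ∫ s, (φ : ℝ → ℝ) s * Gbar N u p r s ∂ρ)
    (φf : Lp ℝ 2 ρ)
    (hφf : ∀ ψ : Lp ℝ 2 ρ,
      ⟪φf, ψ⟫ = (N : ℝ)⁻¹ * ∑ i, ∫ x, LopLp R₀ ψ (u i) x * (f i : ℝ → ℝ) x) :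
    lossE R₀ N u (fun i => (f i : ℝ → ℝ)) φ
      = ⟪Tφ, φ⟫ - 2 * ⟪φf, φ⟫ + (N : ℝ)⁻¹ * ∑ i, ∫ x, ((f i : ℝ → ℝ) x) ^ 2 := by
  classical
  have hpm : AEMeasurable (fun r => ENNReal.ofReal (p r)) (volume.restrict (Set.Icc 0 R₀)) :=
    (hpc.aemeasurable measurableSet_Icc).ennreal_ofReal
  have hlt : ∀ᵐ r ∂(volume.restrict (Set.Icc 0 R₀)), ENNReal.ofReal (p r) < ∞ :=
    Filter.Eventually.of_forall fun r => ENNReal.ofReal_lt_top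
  have hIntg : ∀ h : ℝ → ℝ, ∫ r, h r ∂ρ = ∫ r in Set.Icc 0 R₀, p r * h r := by
    intro h
    rw [hρ, integral_withDensity_eq_integral_toReal_smul₀ hpm hlt]
    refine setIntegral_congr_fun measurableSet_Icc fun r hr => ?_
    simp [ENNReal.toReal_ofReal (hpp r hr).le]
  set g : ℝ → ℝ := (Set.Icc 0 R₀).indicator (φ : ℝ → ℝ) with hgdef
  have hgm : StronglyMeasurable g := (Lp.stronglyMeasurable φ).indicator measurableSet_Icc
  have hg0 : ∀ r, r ∉ Set.Icc 0 R₀ → g r = 0 := fun r hr => Set.indicator_of_notMem hr _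
  have hg : Integrable g := by
    have h1 : Integrable (φ : ℝ → ℝ) ρ := (Lp.memLp φ).integrable (by norm_num)
    have h2 : Integrable (φ : ℝ → ℝ) ((volume.restrict (Set.Icc 0 R₀)).withDensity
        fun r => ENNReal.ofReal (p r)) := hρ ▸ h1
    rw [integrable_withDensity_iff_integrable_smul₀' hpm hlt] at h2
    have hinv : ContinuousOn (fun r => (p r)⁻¹) (Set.Icc 0 R₀) :=
      hpc.inv₀ fun r hr => (hpp r hr).ne'
    obtain ⟨C, hC⟩ := isCompact_Icc.exists_bound_of_continuousOn hinv
    have h3 := h2.bdd_mul (c := C) (hinv.aestronglyMeasurable measurableSet_Icc)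
      ((ae_restrict_iff' measurableSet_Icc).2 (Filter.Eventually.of_forall hC))
    rw [hgdef, integrable_indicator_iff measurableSet_Icc]
    refine h3.congr ?_
    filter_upwards [ae_restrict_mem measurableSet_Icc] with r hr
    simp only [smul_eq_mul, ENNReal.toReal_ofReal (hpp r hr).le]
    rw [inv_mul_cancel_left₀ (hpp r hr).ne']
  have hL : ∀ i x, LopLp R₀ φ (u i) x = ∫ r, g r * secDiff (u i) x r := by
    intro i x
    obtain ⟨M, hM⟩ := (hcs i).exists_bound_of_continuous (hu i)
    exact lop_eq hgm hg hg0 (hu i) hM x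
  have hT : ⟪Tφ, φ⟫ = (N : ℝ)⁻¹ * ∑ i, ∫ x, (LopLp R₀ φ (u i) x) ^ 2 := by
    have e1 : ⟪Tφ, φ⟫ = ∫ r, (φ : ℝ → ℝ) r * (∫ s, (φ : ℝ → ℝ) s * Gbar N u p r s ∂ρ) ∂ρ := by
      rw [L2.inner_def]
      refine integral_congr_ae ?_
      filter_upwards [hTφ] with r hr
      rw [← hr]
      simp
    have e2 : ∀ r ∈ Set.Icc 0 R₀, p r * ((φ : ℝ → ℝ) r * (∫ s, (φ : ℝ → ℝ) s * Gbar N u p r s ∂ρ))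
        = ∫ s, g r * g s * Gker N u r s := by
      intro r hr
      rw [hIntg, ← mul_assoc, ← integral_const_mul]
      rw [← setIntegral_eq_integral_of_forall_compl_eq_zero (s := Set.Icc 0 R₀) (μ := volume)
        (f := fun s => g r * g s * Gker N u r s)
        (fun s hs => by rw [hg0 s hs]; ring)]
      refine setIntegral_congr_fun measurableSet_Icc fun s hs => ?_
      have h1 := (hpp r hr).ne'
      have h2 := (hpp s hs).ne'
      simp only [hgdef, Set.indicator_of_mem hr, Set.indicator_of_mem hs, Gbar]
      field_simp
    have hK := fun i => integrable_pair hgm hg hg0 (hu i) (hcs i)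
    have e4 : ∀ r s, g r * g s * Gker N u r s = (N : ℝ)⁻¹ * ∑ i,
        (g r * g s * ∫ x, secDiff (u i) x r * secDiff (u i) x s) := by
      intro r s
      rw [← Finset.mul_sum, Gker]
      simp only [secDiff]
      ring
    rw [e1, hIntg, setIntegral_congr_fun measurableSet_Icc e2,
      setIntegral_eq_integral_of_forall_compl_eq_zero (fun r hr => by simp [hg0 r hr])]
    simp_rw [e4, hL]
    have hK' : Integrable (fun q : ℝ × ℝ => (N : ℝ)⁻¹ * ∑ i,
        (g q.1 * g q.2 * ∫ x, secDiff (u i) x q.1 * secDiff (u i) x q.2)) (volume.prod volume) :=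
      (integrable_finsetSum _ fun i _ => hK i).const_mul _
    rw [← integral_prod _ hK', integral_const_mul, integral_finsetSum _ fun i _ => hK i]
    congr 1
    refine Finset.sum_congr rfl fun i _ => ?_
    rw [integral_lop_sq hgm hg hg0 (hu i) (hcs i)]
  rw [hT, hφf φ, lossE]
  have hexp : ∀ i, ∫ x, (LopLp R₀ φ (u i) x - (f i : ℝ → ℝ) x) ^ 2 =
      (∫ x, (LopLp R₀ φ (u i) x) ^ 2) - 2 * (∫ x, LopLp R₀ φ (u i) x * (f i : ℝ → ℝ) x)
        + ∫ x, ((f i : ℝ → ℝ) x) ^ 2 := by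
    intro i
    have m1 : MemLp (fun x => LopLp R₀ φ (u i) x) 2 volume := by
      simp_rw [hL]
      exact memLp_lop hgm hg hg0 (hu i) (hcs i)
    have m2 : MemLp (f i : ℝ → ℝ) 2 volume := Lp.memLp (f i)
    have m3 : Integrable (fun x => LopLp R₀ φ (u i) x * (f i : ℝ → ℝ) x) := m1.integrable_mul m2
    have m4 := m1.integrable_sq
    rw [← integral_const_mul, ← integral_sub m4 (m3.const_mul 2),
      ← integral_add (f := fun x => LopLp R₀ φ (u i) x ^ 2 - 2 * (LopLp R₀ φ (u i) x * (f i : ℝ → ℝ) x))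
        (m4.sub (m3.const_mul 2)) m2.integrable_sq]
    congr 1
    ext x
    ring
  simp_rw [hexp]
  rw [Finset.sum_add_distrib, Finset.sum_sub_distrib, ← Finset.mul_sum]
  ring
end
end
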